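/- Let f_1, …, f_k : ℕ → ℕ be functions given by polynomials with integer coefficients, and for each n let S_n ⊆ ℕ be the additive submonoid generated by f_1(n), …, f_k(n). Then there is an eventually quasi-polynomial function g : ℕ → ℤ such that for every n for which ℕ \ S_n is finite, the type of S_n (the cardinality of the set PF(S_n) = {x ∈ ℤ : x ∉ S_n and x + s ∈ S_n for all s ∈ S_n with s ≠ 0}, where S_n is regarded as a subset of ℤ) equals g(n). -/

import Mathlib

/-- A function `c : ℕ → ℚ` is eventually periodic if there are `N` and `p ≥ 1`
with `c (n + p) = c n` for all `n ≥ N`. -/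
def EvPeriodic (c : ℕ → ℚ) : Prop :=
  ∃ N p : ℕ, 1 ≤ p ∧ ∀ n, N ≤ n → c (n + p) = c n

/-- A function `g : ℕ → ℤ` is eventually quasi-polynomial if
`g n = Σ_{i=0}^d c_i(n)·n^i` for eventually periodic `c_0, …, c_d : ℕ → ℚ`. -/
def IsEQP (g : ℕ → ℤ) : Prop :=
  ∃ (d : ℕ) (c : ℕ → ℕ → ℚ), (∀ i, i ≤ d → EvPeriodic (c i)) ∧
    ∀ n : ℕ, (g n : ℚ) = ∑ i ∈ Finset.range (d + 1), c i n * (n : ℚ) ^ i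

/-- The additive submonoid of `ℕ` generated by `f 0 n, …, f (k-1) n`. -/
def SG (k : ℕ) (f : Fin k → ℕ → ℕ) (n : ℕ) : AddSubmonoid ℕ :=
  AddSubmonoid.closure (Set.range fun i => f i n)

/-- The image of `SG k f n` in `ℤ`. -/
def SGZ (k : ℕ) (f : Fin k → ℕ → ℕ) (n : ℕ) : Set ℤ :=
  (fun m : ℕ => (m : ℤ)) '' (SG k f n : Set ℕ)

/-- The set of pseudo-Frobenius numbers of `SG k f n`, as a subset of `ℤ`. -/
def PF (k : ℕ) (f : Fin k → ℕ → ℕ) (n : ℕ) : Set ℤ :=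
  {x : ℤ | x ∉ SGZ k f n ∧ ∀ s ∈ SGZ k f n, s ≠ 0 → x + s ∈ SGZ k f n}

open Polynomial in
/-- `g` agrees, for large `n`, with a polynomial on each residue class modulo some `p ≥ 1`. -/
def EventuallyQuasiPoly (g : ℕ → ℚ) : Prop :=
  ∃ (N p : ℕ) (P : ℕ → ℚ[X]), 1 ≤ p ∧ ∀ n, N ≤ n → g n = (P (n % p)).eval (n : ℚ)

namespace EventuallyQuasiPoly

open Polynomial

variable {g g' : ℕ → ℚ}

theorem congr (hg : EventuallyQuasiPoly g) (N : ℕ) (h : ∀ n, N ≤ n → g' n = g n) :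
    EventuallyQuasiPoly g' := by
  obtain ⟨N₁, p, P, hp, hP⟩ := hg
  refine ⟨max N N₁, p, P, hp, fun n hn => ?_⟩
  rw [h n (le_of_max_le_left hn), hP n (le_of_max_le_right hn)]

theorem of_eventually_eq_zero (N : ℕ) (h : ∀ n, N ≤ n → g n = 0) : EventuallyQuasiPoly g :=
  ⟨N, 1, 0, le_rfl, fun n hn => by simp [h n hn]⟩

theorem neg (hg : EventuallyQuasiPoly g) : EventuallyQuasiPoly fun n => -g n := by
  obtain ⟨N, p, P, hp, hP⟩ := hg
  exact ⟨N, p, fun r => -P r, hp, fun n hn => by simp [hP n hn]⟩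

theorem add (hg : EventuallyQuasiPoly g) (hg' : EventuallyQuasiPoly g') :
    EventuallyQuasiPoly fun n => g n + g' n := by
  obtain ⟨N, p, P, hp, hP⟩ := hg
  obtain ⟨N', p', P', hp', hP'⟩ := hg'
  refine ⟨max N N', p * p', fun r => P (r % p) + P' (r % p'), Nat.mul_pos hp hp', fun n hn => ?_⟩
  beta_reduce
  rw [hP n (le_of_max_le_left hn), hP' n (le_of_max_le_right hn), eval_add,
    Nat.mod_mul_right_mod, Nat.mod_mul_left_mod]

theorem sub (hg : EventuallyQuasiPoly g) (hg' : EventuallyQuasiPoly g') :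
    EventuallyQuasiPoly fun n => g n - g' n := by
  simpa only [sub_eq_add_neg] using hg.add hg'.neg

theorem comp_add (hg : EventuallyQuasiPoly g) (c : ℕ) :
    EventuallyQuasiPoly fun n => g (n + c) := by
  obtain ⟨N, p, P, hp, hP⟩ := hg
  refine ⟨N, p, fun r => (P ((r + c) % p)).comp (X + C (c : ℚ)), hp, fun n hn => ?_⟩
  beta_reduce
  rw [hP _ (by omega)]
  simp

theorem comp_sub (hg : EventuallyQuasiPoly g) (c : ℕ) :
    EventuallyQuasiPoly fun n => g (n - c) := by
  obtain ⟨N, p, P, hp, hP⟩ := hg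
  refine ⟨N + c, p, fun r => (P ((r + (p * c - c)) % p)).comp (X - C (c : ℚ)), hp,
    fun n hn => ?_⟩
  have hc : c ≤ p * c := Nat.le_mul_of_pos_left c hp
  have hmod : (n % p + (p * c - c)) % p = (n - c) % p := by
    rw [Nat.mod_add_mod, show n + (p * c - c) = n - c + p * c by omega, Nat.add_mul_mod_self_left]
  beta_reduce
  rw [hP _ (by omega), hmod]
  simp [Nat.cast_sub (show c ≤ n by omega)]

/-- Every rational polynomial is the difference, with nonzero step `q`, of some polynomial. -/
theorem exists_difference_eq (q : ℚ) (hq : q ≠ 0) (R : ℚ[X]) :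
    ∃ U : ℚ[X], ∀ x : ℚ, U.eval (x + q) - U.eval x = R.eval x := by
  suffices h : ∀ d, ∀ R : ℚ[X], R.natDegree < d →
      ∃ U : ℚ[X], ∀ x : ℚ, U.eval (x + q) - U.eval x = R.eval x from
    h (R.natDegree + 1) R (Nat.lt_succ_self _)
  intro d
  induction d with
  | zero => intro R hR; omega
  | succ d ih =>
    intro R hR
    have hd : ((d : ℚ) + 1) * q ≠ 0 := mul_ne_zero (by positivity) hq
    set a : ℚ := R.coeff d / (((d : ℚ) + 1) * q) with ha
    set T : ℚ[X] := R - C a * ((X + C q) ^ (d + 1) - X ^ (d + 1)) with hT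
    have hcoeff : ∀ i, d ≤ i → T.coeff i = 0 := by
      intro i hi
      rw [hT, coeff_sub, coeff_C_mul, coeff_sub, coeff_X_add_C_pow, coeff_X_pow]
      rcases hi.eq_or_lt with rfl | hi
      · simp [Nat.choose_succ_self_right, ha]
        field_simp
        ring
      · rw [coeff_eq_zero_of_natDegree_lt (by omega)]
        rcases (Nat.succ_le_of_lt hi).eq_or_lt with h | h
        · subst h; simp
        · rw [Nat.choose_eq_zero_of_lt (by omega), if_neg (by omega)]; simp
    have : ∃ V : ℚ[X], ∀ x : ℚ, V.eval (x + q) - V.eval x = T.eval x := by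
      by_cases hT0 : T = 0
      · exact ⟨0, by simp [hT0]⟩
      · exact ih T ((natDegree_lt_iff_degree_lt hT0).2
          ((degree_lt_iff_coeff_zero _ _).2 hcoeff))
    obtain ⟨V, hV⟩ := this
    refine ⟨V + C a * X ^ (d + 1), fun x => ?_⟩
    have := hV x
    simp only [hT, eval_sub, eval_add, eval_mul, eval_C, eval_pow, eval_X] at this ⊢
    linear_combination this

/-- A function with quasi-polynomial `w`-step difference is itself quasi-polynomial. -/
theorem of_difference {w : ℕ} (hw : 1 ≤ w) (h : EventuallyQuasiPoly fun n => g (n + w) - g n) :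
    EventuallyQuasiPoly g := by
  obtain ⟨N, p, P, hp, hP⟩ := h
  set q := p * w with hq
  have hq0 : 1 ≤ q := Nat.mul_pos hp hw
  let R : ℕ → ℚ[X] := fun r =>
    ∑ j ∈ Finset.range p, (P ((r + j * w) % p)).comp (X + C ((j * w : ℕ) : ℚ))
  have hR : ∀ n, N ≤ n → g (n + q) - g n = (R (n % p)).eval (n : ℚ) := by
    intro n hn
    have := Finset.sum_range_sub (fun j => g (n + j * w)) p
    simp only [zero_mul, add_zero] at this
    rw [hq, ← this, eval_finsetSum]
    refine Finset.sum_congr rfl fun j _ => ?_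
    have : g (n + j * w + w) - g (n + j * w) = _ := hP (n + j * w) (by omega)
    rw [show n + (j + 1) * w = n + j * w + w by ring, this]
    simp
  choose U hU using fun r => exists_difference_eq (q : ℚ) (by positivity) (R r)
  let k : ℕ → ℚ := fun n => g n - (U (n % p)).eval (n : ℚ)
  have hk : ∀ n, N ≤ n → k (n + q) = k n := by
    intro n hn
    have h₁ := hR n hn
    have h₂ := hU (n % p) n
    have h₃ : (n + q) % p = n % p := by simp [hq]
    simp only [k, h₃]
    push_cast
    linear_combination h₁ - h₂
  have hk' : ∀ m n, N ≤ n → k (n + q * m) = k n := by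
    intro m
    induction m with
    | zero => simp
    | succ m ih =>
      intro n hn
      rw [Nat.mul_succ, ← add_assoc, hk _ (by omega), ih n hn]
  refine ⟨q * N, q, fun r => U (r % p) + C (k (r + q * N)), hq0, fun n hn => ?_⟩
  have hdiv : N ≤ n / q := (Nat.le_div_iff_mul_le hq0).2 (by rwa [mul_comm])
  have hn' : n = n % q + q * N + q * (n / q - N) := by
    rw [add_assoc, ← Nat.mul_add, Nat.add_sub_cancel' hdiv, Nat.mod_add_div]
  have hNq : N ≤ q * N := Nat.le_mul_of_pos_left N hq0
  have hkn : k n = k (n % q + q * N) := by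
    conv_lhs => rw [hn']
    exact hk' _ _ (by omega)
  rw [eval_add, eval_C, ← hkn, hq, Nat.mod_mul_right_mod]
  simp [k]

theorem isEQP {g : ℕ → ℤ} (hg : EventuallyQuasiPoly fun n => (g n : ℚ)) : IsEQP g := by
  obtain ⟨N, p, P, hp, hP⟩ := hg
  set d := (Finset.range p).sup fun r => (P r).natDegree with hd
  refine ⟨d, fun i n => if N ≤ n then (P (n % p)).coeff i else if i = 0 then (g n : ℚ) else 0,
    fun i _ => ⟨N, p, hp, fun n hn => ?_⟩, fun n => ?_⟩
  · simp [hn, le_add_right hn]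
  · by_cases hn : N ≤ n
    · simp only [hn, if_true]
      refine (hP n hn).trans ?_
      refine eval_eq_sum_range' (Nat.lt_succ_of_le ?_) _
      exact Finset.le_sup (f := fun r => (P r).natDegree)
        (Finset.mem_range.2 (Nat.mod_lt _ hp))
    · simp [hn]

end EventuallyQuasiPoly

open Set Pointwise

/-- The affine map `l ↦ b + ∑ j, l j • p j` parametrising a linear set. -/
def cellMap {ι : Type} {s : ℕ} (b : ι → ℕ) (p : Fin s → ι → ℕ) (l : Fin s → ℕ) : ι → ℕ :=
  b + ∑ j, l j • p j

/-- The image of `ℕ ^ s` under an injective affine map. -/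
def IsCell {ι : Type} (s : ℕ) (L : Set (ι → ℕ)) : Prop :=
  ∃ (b : ι → ℕ) (p : Fin s → ι → ℕ), (cellMap b p).Injective ∧ L = range (cellMap b p)

/-- A set covered by finitely many cells of dimension less than `r`. -/
def IsThin {ι : Type} (r : ℕ) (B : Set (ι → ℕ)) : Prop :=
  ∃ S : Set (Set (ι → ℕ)), S.Finite ∧ (∀ L ∈ S, ∃ s < r, IsCell s L) ∧ B ⊆ ⋃₀ S

section Cells

variable {ι : Type} {r s : ℕ} {A B : Set (ι → ℕ)}

theorem IsThin.mono (hB : IsThin r B) (h : A ⊆ B) : IsThin r A := by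
  obtain ⟨S, hS, hS', hB⟩ := hB
  exact ⟨S, hS, hS', h.trans hB⟩

theorem IsThin.union (hA : IsThin r A) (hB : IsThin r B) : IsThin r (A ∪ B) := by
  obtain ⟨S, hS, hS', hA⟩ := hA
  obtain ⟨T, hT, hT', hB⟩ := hB
  refine ⟨S ∪ T, hS.union hT, fun L hL => hL.elim (hS' L) (hT' L), ?_⟩
  rw [sUnion_union]
  exact union_subset_union hA hB

theorem IsThin.empty : IsThin r (∅ : Set (ι → ℕ)) :=
  ⟨∅, finite_empty, by simp, by simp⟩

theorem IsCell.isThin (hA : IsCell s A) (h : s < r) : IsThin r A :=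
  ⟨{A}, finite_singleton A, by simpa using ⟨s, h, hA⟩, by simp⟩

theorem IsThin.iUnion {κ : Type*} [Finite κ] {T : κ → Set (ι → ℕ)}
    (hT : ∀ i, IsThin r (T i)) : IsThin r (⋃ i, T i) := by
  choose S hS hS' hB using hT
  refine ⟨⋃ i, S i, finite_iUnion hS, ?_, ?_⟩
  · intro L hL
    obtain ⟨i, hi⟩ := mem_iUnion.1 hL
    exact hS' i L hi
  · rw [sUnion_iUnion]
    exact iUnion_mono hB

theorem cellMap_injective_iff (b b' : ι → ℕ) (p : Fin s → ι → ℕ) :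
    (cellMap b p).Injective ↔ (cellMap b' p).Injective := by
  simp [Function.Injective, cellMap]

theorem cellMap_injective_ne_zero {b : ι → ℕ} {p : Fin s → ι → ℕ}
    (hp : (cellMap b p).Injective) (j : Fin s) : p j ≠ 0 := by
  intro h0
  have := congr_fun (@hp 0 (Pi.single j 1) (by simp [cellMap, h0, Pi.single_apply])) j
  simp at this

theorem IsCell.vadd (hA : IsCell s A) (v : ι → ℕ) : IsCell s (v +ᵥ A) := by
  obtain ⟨b, p, hp, rfl⟩ := hA
  refine ⟨v + b, p, (cellMap_injective_iff _ _ _).1 hp, ?_⟩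
  ext x
  simp [mem_vadd_set, cellMap, add_assoc]

theorem IsProperLinearSet.exists_isCell (hA : IsProperLinearSet A) : ∃ s, IsCell s A := by
  obtain ⟨b, t, ht, rfl⟩ := isProperLinearSet_iff.1 hA
  let e := t.equivFin
  have hsum : ∀ l : Fin t.card → ℕ,
      ∑ j, l j • (e.symm j : ι → ℕ) = ∑ x : t, l (e x) • (x : ι → ℕ) :=
    fun l => Fintype.sum_equiv e.symm _ _ (by simp)
  refine ⟨t.card, b, fun j => (e.symm j : ι → ℕ), ?_, ?_⟩
  · intro l l' h
    simp only [cellMap, add_right_inj, hsum] at h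
    have := Fintype.linearIndependent_iffₛ.1 ht (fun x => l (e x)) (fun x => l' (e x)) h
    ext j
    simpa using this (e.symm j)
  · ext x
    simp only [mem_vadd_set, SetLike.mem_coe, AddSubmonoid.mem_closure_finset', mem_range, cellMap,
      hsum, vadd_eq_add]
    constructor
    · rintro ⟨_, ⟨l, rfl⟩, rfl⟩
      refine ⟨fun j => l (e.symm j), ?_⟩
      simp
    · rintro ⟨l, rfl⟩
      exact ⟨_, ⟨fun x => l (e x), rfl⟩, rfl⟩

theorem IsCell.linearIndependent_int {b : ι → ℕ} {p : Fin s → ι → ℕ}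
    (hp : (cellMap b p).Injective) :
    LinearIndependent ℤ fun j => (fun i => (p j i : ℤ) : ι → ℤ) := by
  rw [Fintype.linearIndependent_iff]
  intro g hg j
  have : (fun j => (g j).toNat) = fun j => (-g j).toNat := by
    apply hp
    simp only [cellMap, add_right_inj]
    ext i
    have hi := congr_fun hg i
    simp only [Finset.sum_apply, Pi.smul_apply, smul_eq_mul, Pi.zero_apply] at hi ⊢
    zify
    rw [← sub_eq_zero, ← Finset.sum_sub_distrib, ← hi]
    refine Finset.sum_congr rfl fun j _ => ?_
    rw [← sub_mul]
    congr 1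
    omega
  have := congr_fun this j
  omega

theorem cellMap_add_smul {b : ι → ℕ} {p : Fin (s + 1) → ι → ℕ} (l : Fin (s + 1) → ℕ)
    (j : Fin (s + 1)) :
    cellMap b p l = cellMap (b + l j • p j) (fun i => p (j.succAbove i))
      (fun i => l (j.succAbove i)) := by
  simp only [cellMap]
  rw [Fin.sum_univ_succAbove _ j, add_assoc]

theorem isCell_facet {b : ι → ℕ} {p : Fin (s + 1) → ι → ℕ} (hp : (cellMap b p).Injective)
    (b' : ι → ℕ) (j : Fin (s + 1)) :
    IsCell s (range (cellMap b' fun i => p (j.succAbove i))) := by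
  refine ⟨_, _, ?_, rfl⟩
  intro l l' h
  have : j.insertNth (α := fun _ => ℕ) 0 l = j.insertNth (α := fun _ => ℕ) 0 l' := by
    apply hp
    simp only [cellMap, add_right_inj] at h ⊢
    simp [Fin.sum_univ_succAbove _ j, -nsmul_eq_mul, -smul_eq_mul, h]
  ext i
  simpa using congr_fun this (j.succAbove i)

/-- Those points of a cell one of whose coordinates is bounded form a thin set. -/
theorem isThin_setOf_coord_lt {b : ι → ℕ} {p : Fin s → ι → ℕ} (hp : (cellMap b p).Injective)
    (hs : s ≤ r) (c : Fin s → ℕ) : IsThin r {x | ∃ l, (∃ j, l j < c j) ∧ cellMap b p l = x} := by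
  cases s with
  | zero => exact IsThin.empty.mono fun x ⟨l, ⟨j, _⟩, _⟩ => j.elim0
  | succ s =>
    refine (IsThin.iUnion (κ := Σ j, Fin (c j)) fun k => (isCell_facet hp
      (b + (k.2 : ℕ) • p k.1) k.1).isThin (r := r) (by omega)).mono ?_
    rintro x ⟨l, ⟨j, hj⟩, rfl⟩
    exact mem_iUnion.2 ⟨⟨j, l j, hj⟩, _, (cellMap_add_smul l j).symm⟩

theorem IsThin.vadd (hA : IsThin r A) (v : ι → ℕ) : IsThin r (v +ᵥ A) := by
  obtain ⟨S, hS, hS', hA⟩ := hA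
  refine ⟨(v +ᵥ ·) '' S, hS.image _, ?_, ?_⟩
  · rintro _ ⟨L, hL, rfl⟩
    obtain ⟨s, hs, hL⟩ := hS' L hL
    exact ⟨s, hs, hL.vadd v⟩
  · rw [sUnion_image, ← vadd_set_sUnion]
    exact vadd_set_mono hA

end Cells

/-- All translates of `A` by multiples of `M • e` differ from `A` only in a thin set. -/
def ShiftThin {r : ℕ} (e : Fin r → ℕ) (A : Set (Fin r → ℕ)) (M : ℕ) : Prop :=
  ∀ M', M ∣ M' → IsThin r (A \ ((M' • e) +ᵥ A)) ∧ IsThin r (((M' • e) +ᵥ A) \ A)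

theorem IsCell.exists_shiftThin {r s : ℕ} {A : Set (Fin r → ℕ)} (hA : IsCell s A)
    (e : Fin r → ℕ) : ∃ M, 1 ≤ M ∧ ShiftThin e A M := by
  by_cases hs : s < r
  · exact ⟨1, le_rfl, fun M' _ => ⟨(hA.isThin hs).mono sdiff_subset,
      ((hA.vadd _).isThin hs).mono sdiff_subset⟩⟩
  obtain ⟨b, p, hp, rfl⟩ := hA
  have hli := IsCell.linearIndependent_int hp
  have hsr : s = r := by
    have := hli.fintype_card_le_finrank
    simp at this
    omega
  subst hsr
  have hdep : ¬ LinearIndependent ℤ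
      (Fin.cons (fun i => (e i : ℤ)) (fun j i => (p j i : ℤ)) : Fin (s + 1) → Fin s → ℤ) := by
    intro h
    have := h.fintype_card_le_finrank
    simp at this
  obtain ⟨g, hg, hg0⟩ : ∃ g : Fin (s + 1) → ℤ, (∀ i, g 0 * (e i : ℤ) +
      ∑ j : Fin s, g j.succ * (p j i : ℤ) = 0) ∧ g 0 ≠ 0 := by
    rw [Fintype.linearIndependent_iff] at hdep
    push Not at hdep
    obtain ⟨g, hg, j, hj⟩ := hdep
    have hg' : ∀ i, g 0 * (e i : ℤ) + ∑ j : Fin s, g j.succ * (p j i : ℤ) = 0 := by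
      intro i
      simpa [Fin.sum_univ_succ] using congr_fun hg i
    refine ⟨g, hg', fun h0 => hj ?_⟩
    have := Fintype.linearIndependent_iff.1 hli (fun j => g j.succ) (by
      ext i
      simpa [h0] using hg' i)
    exact Fin.cases h0 this j
  obtain ⟨c, hc⟩ : ∃ c : Fin s → ℤ, ∀ i, ((g 0).natAbs : ℤ) * (e i : ℤ) =
      ∑ j, c j * (p j i : ℤ) := by
    refine ⟨fun j => -(g 0).sign * g j.succ, fun i => ?_⟩
    rw [← Int.sign_mul_self_eq_natAbs]
    simp_rw [mul_assoc, ← Finset.mul_sum]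
    linear_combination (g 0).sign * hg i
  refine ⟨(g 0).natAbs, Int.natAbs_pos.2 hg0, ?_⟩
  rintro _ ⟨k, rfl⟩
  set v := ((g 0).natAbs * k) • e with hv
  have hvi : ∀ i, (v i : ℤ) = ∑ j, (k * c j) * (p j i : ℤ) := by
    intro i
    simp_rw [mul_assoc, ← Finset.mul_sum, ← hc]
    simp [hv]
    ring
  -- translating by `v` shifts the coordinate vector by `k • c`
  have hshift : ∀ l l' : Fin s → ℕ, (∀ j, (l j : ℤ) = l' j + k * c j) →
      cellMap b p l = v + cellMap b p l' := by
    intro l l' h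
    ext i
    zify
    simp only [cellMap, Pi.add_apply, Finset.sum_apply, Pi.smul_apply, smul_eq_mul]
    push_cast
    simp_rw [hvi, h, add_mul, Finset.sum_add_distrib]
    ring
  constructor
  · refine (isThin_setOf_coord_lt hp le_rfl fun j => (k * c j).toNat).mono ?_
    rintro _ ⟨⟨l, rfl⟩, hx⟩
    refine ⟨l, ?_, rfl⟩
    by_contra! hl
    refine hx (mem_vadd_set.2 ⟨_, mem_range_self fun j => (l j - k * c j).toNat, ?_⟩)
    refine (hshift _ _ fun j => ?_).symm
    have := hl j
    omega
  · refine ((isThin_setOf_coord_lt hp le_rfl fun j => (-(k * c j)).toNat).vadd v).mono ?_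
    rintro _ ⟨hx, hx'⟩
    obtain ⟨_, ⟨l, rfl⟩, rfl⟩ := mem_vadd_set.1 hx
    refine mem_vadd_set.2 ⟨_, ⟨l, ?_, rfl⟩, rfl⟩
    by_contra! hl
    refine hx' ⟨fun j => (l j + k * c j).toNat, hshift _ _ fun j => ?_⟩
    have := hl j
    omega

theorem IsSemilinearSet.exists_shiftThin {r : ℕ} {A : Set (Fin r → ℕ)} (hA : IsSemilinearSet A)
    (e : Fin r → ℕ) : ∃ M, 1 ≤ M ∧ ShiftThin e A M := by
  obtain ⟨S, hS, hS', rfl⟩ := hA.isProperSemilinearSet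
  induction S, hS using Finite.induction_on with
  | empty => exact ⟨1, le_rfl, fun M' _ => by simpa using IsThin.empty⟩
  | @insert L S _ hS ih =>
    have hS'' : ∀ t ∈ S, IsProperLinearSet t := fun t ht => hS' t (mem_insert_of_mem _ ht)
    obtain ⟨M, hM, hM'⟩ := ih hS''
      (IsProperSemilinearSet.isSemilinearSet ⟨S, hS, hS'', rfl⟩)
    obtain ⟨s, hL⟩ := (hS' L (mem_insert _ _)).exists_isCell
    obtain ⟨K, hK, hK'⟩ := hL.exists_shiftThin e
    refine ⟨M * K, Nat.mul_pos hM hK, fun M' hdvd => ?_⟩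
    obtain ⟨h₁, h₂⟩ := hM' M' ((Dvd.intro _ rfl).trans hdvd)
    obtain ⟨h₃, h₄⟩ := hK' M' ((Dvd.intro_left _ rfl).trans hdvd)
    rw [sUnion_insert, vadd_set_union]
    refine ⟨(h₃.union h₁).mono ?_, (h₄.union h₂).mono ?_⟩ <;>
    · intro x hx
      simp only [mem_sdiff, mem_union] at hx ⊢
      tauto

/-- The level set of `h` over `n` in `A`. -/
def levelSet {M : Type} [AddMonoid M] (A : Set M) (h : M →+ ℕ) (n : ℕ) : Set M :=
  {x ∈ A | h x = n}

/-- The level sets of `h` in `A` are finite, and their sizes are eventually quasi-polynomial. -/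
def CountsQuasiPoly {M : Type} [AddMonoid M] (A : Set M) (h : M →+ ℕ) : Prop :=
  (∀ n, (levelSet A h n).Finite) ∧ EventuallyQuasiPoly fun n => ((levelSet A h n).ncard : ℚ)

section Counting

variable {ι : Type} [Finite ι] {r s : ℕ}

theorem finite_levelSet (A : Set (ι → ℕ)) (h : (ι → ℕ) →+ ℕ) (hh : ∀ x, h x = 0 → x = 0) (n : ℕ) :
    (levelSet A h n).Finite := by
  classical
  have := Fintype.ofFinite ι
  refine (finite_Iic fun _ : ι => n).subset ?_
  rintro x ⟨-, rfl⟩ i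
  have hle : Pi.single i (x i) ≤ x := by
    intro j
    by_cases hj : j = i
    · subst hj; simp
    · simp [hj]
  have h1 : h x = h (Pi.single i (x i)) + h (x - Pi.single i (x i)) := by
    rw [← map_add, add_tsub_cancel_of_le hle]
  have h2 : (Pi.single i (x i) : ι → ℕ) = x i • Pi.single i 1 := by
    simp [← Pi.single_smul]
  rw [h2, map_nsmul, smul_eq_mul] at h1
  have h3 : 1 ≤ h (Pi.single i 1) := Nat.one_le_iff_ne_zero.2 fun h0 => by
    simpa using congr_fun (hh _ h0) i
  have := Nat.le_mul_of_pos_right (x i) h3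
  simp only
  omega

theorem isSemilinearSet_preimage_cellMap {A : Set (ι → ℕ)} (hA : IsSemilinearSet A)
    (b : ι → ℕ) (p : Fin s → ι → ℕ) : IsSemilinearSet (cellMap b p ⁻¹' A) := by
  let F : (Fin s → ℕ) →+ (ι → ℕ) := (Fintype.linearCombination ℕ p).toAddMonoidHom
  have h₁ := isSemilinearSet_setOfPred_eq (M := (Fin s → ℕ) × (ι → ℕ)) b 0
    (F.comp (AddMonoidHom.fst _ _)) (AddMonoidHom.snd _ _)
  have h₂ := hA.preimage (AddMonoidHom.snd (Fin s → ℕ) (ι → ℕ))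
  convert (h₁.inter h₂).image (AddMonoidHom.fst _ _) using 1
  ext l
  simp [cellMap, F, Fintype.linearCombination_apply]

/-- Counting for every semilinear subset of `ℕ ^ s` and positive weight. -/
def CountsInDim (s : ℕ) : Prop :=
  ∀ (A : Set (Fin s → ℕ)) (h : (Fin s → ℕ) →+ ℕ), IsSemilinearSet A →
    (∀ x, h x = 0 → x = 0) → CountsQuasiPoly A h

theorem CountsQuasiPoly.inter_range_cellMap {A : Set (ι → ℕ)} (hA : IsSemilinearSet A)
    (ih : CountsInDim s) (h : (ι → ℕ) →+ ℕ) {b : ι → ℕ} {p : Fin s → ι → ℕ}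
    (hp : (cellMap b p).Injective) (hpos : ∀ j, h (p j) ≠ 0) :
    CountsQuasiPoly (A ∩ range (cellMap b p)) h := by
  let F : (Fin s → ℕ) →+ (ι → ℕ) := (Fintype.linearCombination ℕ p).toAddMonoidHom
  have hF : ∀ l, cellMap b p l = b + F l := fun l => by
    simp [cellMap, F, Fintype.linearCombination_apply]
  obtain ⟨hfin, hqp⟩ := ih (cellMap b p ⁻¹' A) (h.comp F)
    (isSemilinearSet_preimage_cellMap hA b p) (by
      intro l hl
      ext j
      simp only [F, AddMonoidHom.comp_apply, LinearMap.toAddMonoidHom_coe,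
        Fintype.linearCombination_apply, map_sum, map_nsmul, smul_eq_mul,
        Finset.sum_eq_zero_iff, mul_eq_zero] at hl
      exact (hl j (Finset.mem_univ j)).resolve_right (hpos j))
  have hlevel : ∀ n, h b ≤ n → levelSet (A ∩ range (cellMap b p)) h n =
      cellMap b p '' levelSet (cellMap b p ⁻¹' A) (h.comp F) (n - h b) := by
    intro n hn
    ext x
    constructor
    · rintro ⟨⟨hx, l, rfl⟩, rfl⟩
      refine ⟨l, ⟨hx, ?_⟩, rfl⟩
      simp [hF]
    · rintro ⟨l, ⟨hx, hl⟩, rfl⟩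
      refine ⟨⟨hx, l, rfl⟩, ?_⟩
      rw [AddMonoidHom.comp_apply] at hl
      rw [hF, map_add, hl]
      omega
  refine ⟨fun n => ?_, (hqp.comp_sub (h b)).congr (h b) fun n hn => ?_⟩
  · by_cases hn : h b ≤ n
    · rw [hlevel n hn]
      exact (hfin _).image _
    · convert finite_empty
      refine eq_empty_of_forall_notMem ?_
      rintro x ⟨⟨_, l, rfl⟩, hl⟩
      rw [hF, map_add] at hl
      omega
  · rw [hlevel n hn, ncard_image_of_injective _ hp]

theorem CountsQuasiPoly.union {M : Type} [AddMonoid M] {A B : Set M} {h : M →+ ℕ}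
    (hA : CountsQuasiPoly A h) (hB : CountsQuasiPoly B h) (hAB : Disjoint A B) :
    CountsQuasiPoly (A ∪ B) h := by
  have hlevel : ∀ n, levelSet (A ∪ B) h n = levelSet A h n ∪ levelSet B h n := by
    intro n
    ext x
    simp only [levelSet, mem_union, mem_ofPred_eq]
    tauto
  refine ⟨fun n => hlevel n ▸ (hA.1 n).union (hB.1 n), ?_⟩
  refine (hA.2.add hB.2).congr 0 fun n _ => ?_
  rw [hlevel, ncard_union_eq _ (hA.1 n) (hB.1 n)]
  · push_cast; rfl
  · exact hAB.mono (fun _ hx => hx.1) (fun _ hx => hx.1)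

theorem CountsQuasiPoly.of_cover {h : (ι → ℕ) →+ ℕ} {S : Set (Set (ι → ℕ))} (hS : S.Finite)
    (hcell : ∀ L ∈ S, ∃ s, CountsInDim s ∧ ∃ (b : ι → ℕ) (p : Fin s → ι → ℕ),
      (cellMap b p).Injective ∧ (∀ j, h (p j) ≠ 0) ∧ L = range (cellMap b p))
    {A : Set (ι → ℕ)} (hA : IsSemilinearSet A) (hAS : A ⊆ ⋃₀ S) : CountsQuasiPoly A h := by
  induction S, hS using Finite.induction_on generalizing A with
  | empty =>
    obtain rfl : A = ∅ := by simpa [subset_empty_iff] using hAS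
    exact ⟨fun n => by simp [levelSet], .of_eventually_eq_zero 0 fun n _ => by simp [levelSet]⟩
  | @insert L S _ hS ih =>
    obtain ⟨s, hs, b, p, hp, hpos, rfl⟩ := hcell L (mem_insert _ _)
    have hL : IsSemilinearSet (range (cellMap b p)) := by
      let F : (Fin s → ℕ) →+ (ι → ℕ) := (Fintype.linearCombination ℕ p).toAddMonoidHom
      convert ((IsSemilinearSet.univ (M := Fin s → ℕ)).image F).vadd b using 1
      ext x
      simp [cellMap, F, Fintype.linearCombination_apply, mem_vadd_set]
    have h₁ := CountsQuasiPoly.inter_range_cellMap hA hs h hp hpos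
    have h₂ := ih (fun L' hL' => hcell L' (mem_insert_of_mem _ hL')) (hA.sdiff hL) (by
      rintro x ⟨hx, hx'⟩
      have := hAS hx
      rw [sUnion_insert] at this
      exact this.resolve_left hx')
    rw [← inter_union_sdiff A (range (cellMap b p))]
    exact h₁.union h₂ disjoint_sdiff_inter.symm

theorem levelSet_vadd {M : Type} [AddCommMonoid M] [IsCancelAdd M] (A : Set M) (h : M →+ ℕ) (v : M)
    (n : ℕ) : levelSet (v +ᵥ A) h (n + h v) = v +ᵥ levelSet A h n := by
  ext x
  constructor
  · rintro ⟨hx, hn⟩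
    obtain ⟨y, hy, rfl⟩ := mem_vadd_set.1 hx
    rw [vadd_eq_add, map_add] at hn
    exact mem_vadd_set.2 ⟨y, ⟨hy, by omega⟩, rfl⟩
  · intro hx
    obtain ⟨y, ⟨hy, rfl⟩, rfl⟩ := mem_vadd_set.1 hx
    exact ⟨mem_vadd_set.2 ⟨y, hy, rfl⟩, by rw [vadd_eq_add, map_add, add_comm]⟩

theorem countsInDim (r : ℕ) : CountsInDim r := by
  induction r using Nat.strong_induction_on with
  | _ r ih =>
  intro A h hA hh
  refine ⟨finite_levelSet A h hh, ?_⟩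
  rcases Nat.eq_zero_or_pos r with rfl | hr
  · refine .of_eventually_eq_zero 1 fun n hn => ?_
    rw [Nat.cast_eq_zero, ncard_eq_zero (finite_levelSet A h hh n)]
    refine eq_empty_of_forall_notMem ?_
    rintro x ⟨-, hx⟩
    rw [Subsingleton.elim x 0, map_zero] at hx
    omega
  have hthin : ∀ B, IsSemilinearSet B → IsThin r B → CountsQuasiPoly B h := by
    rintro B hB ⟨S, hS, hS', hBS⟩
    refine .of_cover hS (fun L hL => ?_) hB hBS
    obtain ⟨s, hs, b, p, hp, hL⟩ := hS' L hL
    exact ⟨s, ih s hs, b, p, hp, fun j hj => cellMap_injective_ne_zero hp j (hh _ hj), hL⟩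
  let e : Fin r → ℕ := Pi.single ⟨0, hr⟩ 1
  obtain ⟨M, hM, hshift⟩ := hA.exists_shiftThin e
  set v := M • e with hv
  obtain ⟨ht₁, ht₂⟩ := hshift M dvd_rfl
  have hw : 1 ≤ h v := Nat.one_le_iff_ne_zero.2 fun h0 => by
    have := congr_fun (hh v h0) ⟨0, hr⟩
    simp [hv, e] at this
    omega
  have hvA := hA.vadd v
  have hq₁ := (hthin _ (hA.sdiff hvA) ht₁).2
  have hq₂ := (hthin _ (hvA.sdiff hA) ht₂).2
  refine .of_difference hw (((hq₁.sub hq₂).comp_add (h v)).congr 0 fun n _ => ?_)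
  have hsd : ∀ B C : Set (Fin r → ℕ),
      levelSet (B \ C) h (n + h v) = levelSet B h (n + h v) \ levelSet C h (n + h v) := by
    intro B C
    ext x
    simp only [levelSet, mem_sdiff, mem_ofPred_eq]
    tauto
  have hcard := ncard_sdiff_add_ncard (levelSet A h (n + h v)) (levelSet (v +ᵥ A) h (n + h v))
    (finite_levelSet _ h hh _) (finite_levelSet _ h hh _)
  have hcard' := ncard_sdiff_add_ncard (levelSet (v +ᵥ A) h (n + h v)) (levelSet A h (n + h v))
    (finite_levelSet _ h hh _) (finite_levelSet _ h hh _)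
  have htrans : (levelSet (v +ᵥ A) h (n + h v)).ncard = (levelSet A h n).ncard := by
    rw [levelSet_vadd]
    exact ncard_image_of_injective _ (add_right_injective v)
  rw [union_comm] at hcard'
  rw [hsd, hsd, ← htrans]
  have := hcard.trans hcard'.symm
  have : ((_ : ℕ) : ℚ) = ((_ : ℕ) : ℚ) := congrArg _ this
  push_cast at this
  linear_combination -this

/-- The level sets of `h` in a semilinear set have eventually quasi-polynomial size if they are
finite. -/
theorem IsSemilinearSet.countsQuasiPoly {A : Set (ι → ℕ)} (hA : IsSemilinearSet A)
    (h : (ι → ℕ) →+ ℕ) (hfin : ∀ n, (levelSet A h n).Finite) :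
    EventuallyQuasiPoly fun n => ((levelSet A h n).ncard : ℚ) := by
  obtain ⟨S, hS, hS', rfl⟩ := hA.isProperSemilinearSet
  refine (CountsQuasiPoly.of_cover hS (fun L hL => ?_) hA le_rfl).2
  obtain ⟨s, b, p, hp, rfl⟩ := (hS' L hL).exists_isCell
  refine ⟨s, countsInDim s, b, p, hp, fun j hj => ?_, rfl⟩
  refine infinite_univ.not_finite (Finite.of_finite_image ((hfin (h b)).subset ?_)
    (f := fun k : ℕ => cellMap b p (Pi.single j k)) ?_)
  · rintro _ ⟨k, -, rfl⟩
    refine ⟨⟨_, hL, mem_range_self _⟩, ?_⟩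
    simp only [cellMap, map_add, map_sum, map_nsmul]
    rw [Finset.sum_eq_single j (by simp +contextual) (by simp)]
    simp [hj]
  · exact (hp.comp (Pi.single_injective j)).injOn

end Counting

section PolynomialForms

variable {ι : Type}

/-- Functions on `ι → ℕ` that are polynomial in the coordinate `i₀`, with coefficients that are
affine forms. -/
inductive IsPolyAffine (i₀ : ι) : ((ι → ℕ) → ℤ) → Prop
  | zero : IsPolyAffine i₀ fun _ => 0
  | step (φ : (ι → ℕ) →+ ℤ) (d : ℤ) {G : (ι → ℕ) → ℤ} (hG : IsPolyAffine i₀ G) :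
      IsPolyAffine i₀ fun w => φ w + d + w i₀ * G w

namespace IsPolyAffine

variable {i₀ : ι} {F G : (ι → ℕ) → ℤ}

theorem add (hF : IsPolyAffine i₀ F) (hG : IsPolyAffine i₀ G) :
    IsPolyAffine i₀ fun w => F w + G w := by
  induction hF generalizing G with
  | zero => simpa using hG
  | step φ d hF ih =>
    cases hG with
    | zero => simpa using step φ d hF
    | step ψ e hG =>
      convert! step (φ + ψ) (d + e) (ih hG) using 2
      simp only [AddMonoidHom.add_apply]
      ring

theorem const_mul (hF : IsPolyAffine i₀ F) (a : ℤ) : IsPolyAffine i₀ fun w => a * F w := by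
  induction hF with
  | zero => simpa using zero
  | step φ d hF ih =>
    convert! step (a • φ) (a * d) ih using 2
    simp only [AddMonoidHom.smul_apply, smul_eq_mul]
    ring

theorem coord_mul (hF : IsPolyAffine i₀ F) : IsPolyAffine i₀ fun w => w i₀ * F w := by
  simpa using step 0 0 hF

theorem coord_pow_mul (hF : IsPolyAffine i₀ F) (m : ℕ) :
    IsPolyAffine i₀ fun w => (w i₀ : ℤ) ^ m * F w := by
  induction m with
  | zero => simpa using hF
  | succ m ih => simpa only [pow_succ', mul_assoc] using ih.coord_mul

theorem eval_mul (hF : IsPolyAffine i₀ F) (p : Polynomial ℤ) :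
    IsPolyAffine i₀ fun w => p.eval (w i₀ : ℤ) * F w := by
  induction p using Polynomial.induction_on' with
  | add p q hp hq => simpa only [Polynomial.eval_add, add_mul] using hp.add hq
  | monomial m a =>
    simpa only [Polynomial.eval_monomial, mul_assoc] using (hF.coord_pow_mul m).const_mul a

theorem sum {κ : Type*} (s : Finset κ) {F : κ → (ι → ℕ) → ℤ}
    (hF : ∀ j ∈ s, IsPolyAffine i₀ (F j)) : IsPolyAffine i₀ fun w => ∑ j ∈ s, F j w := by
  classical
  induction s using Finset.induction_on with
  | empty => simpa using zero
  | insert a s ha ih =>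
    simp only [Finset.sum_insert ha]
    exact (hF a (by simp)).add (ih fun j hj => hF j (by simp [hj]))

theorem coord (i : ι) : IsPolyAffine i₀ fun w => (w i : ℤ) := by
  simpa using step ((Nat.castAddMonoidHom ℤ).comp (Pi.evalAddMonoidHom _ i)) 0 zero

theorem eval (p : Polynomial ℤ) : IsPolyAffine i₀ fun w => p.eval (w i₀ : ℤ) := by
  simpa using (step 0 1 zero : IsPolyAffine i₀ _).eval_mul p

/-- The base `w i₀` number with digits `w (d j)`. -/
theorem digits {e : ℕ} (d : Fin e → ι) :
    IsPolyAffine i₀ fun w => ∑ j, (w (d j) : ℤ) * (w i₀ : ℤ) ^ (j : ℕ) :=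
  sum _ fun j _ => by simpa only [mul_comm] using (coord (d j)).coord_pow_mul (j : ℕ)

end IsPolyAffine

variable [Finite ι]

theorem exists_abs_le_mul (φ : (ι → ℕ) →+ ℤ) (i₀ : ι) :
    ∃ C : ℤ, ∀ w : ι → ℕ, (∀ i, w i ≤ w i₀) → |φ w| ≤ C * w i₀ := by
  classical
  have := Fintype.ofFinite ι
  refine ⟨∑ i, |φ (Pi.single i 1)|, fun w hw => ?_⟩
  have hφ : φ w = ∑ i, (w i : ℤ) * φ (Pi.single i 1) := by
    conv_lhs => rw [← Finset.univ_sum_single w, map_sum]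
    refine Finset.sum_congr rfl fun i _ => ?_
    rw [← nsmul_eq_mul, ← map_nsmul, ← Pi.single_smul]
    simp
  rw [hφ, Finset.sum_mul]
  refine (Finset.abs_sum_le_sum_abs _ _).trans (Finset.sum_le_sum fun i _ => ?_)
  rw [abs_mul, Nat.abs_cast, mul_comm]
  have : (w i : ℤ) ≤ w i₀ := by exact_mod_cast hw i
  gcongr

/-- Polynomial equations with affine coefficients define semilinear sets where the main coordinate
`i₀` dominates: the coefficients are compared one at a time, with bounded carries. -/
theorem IsPolyAffine.isSemilinearSet {i₀ : ι} {F : (ι → ℕ) → ℤ} (hF : IsPolyAffine i₀ F)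
    {B : Set (ι → ℕ)} (hB : IsSemilinearSet B) (hB' : ∀ w ∈ B, 1 ≤ w i₀ ∧ ∀ i, w i ≤ w i₀) (c : ℤ) :
    IsSemilinearSet {w ∈ B | F w + c = 0} := by
  induction hF generalizing c with
  | zero =>
    by_cases hc : c = 0
    · simpa [hc] using hB
    · simp [hc]
  | @step φ d G hG ih =>
    obtain ⟨C, hC⟩ := exists_abs_le_mul φ i₀
    have key : {w ∈ B | φ w + d + w i₀ * G w + c = 0} =
        ⋃ q ∈ Icc (-(C + |d + c|)) (C + |d + c|),
          ({w | (d + c) + φ w = 0 + (q • (Nat.castAddMonoidHom ℤ).comp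
            (Pi.evalAddMonoidHom (fun _ : ι => ℕ) i₀)) w} ∩ {w ∈ B | G w + q = 0}) := by
      ext w
      simp only [mem_ofPred_eq, mem_iUnion, mem_inter_iff, AddMonoidHom.smul_apply,
        AddMonoidHom.comp_apply, Pi.evalAddMonoidHom_apply, Nat.coe_castAddMonoidHom, smul_eq_mul,
        exists_prop]
      constructor
      · rintro ⟨hw, h⟩
        refine ⟨-G w, ?_, by linear_combination h, hw, by ring⟩
        obtain ⟨h1, h2⟩ := hB' w hw
        have h3 := hC w h2
        have h1' : (1 : ℤ) ≤ w i₀ := by exact_mod_cast h1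
        have h4 : |G w| * w i₀ ≤ (C + |d + c|) * w i₀ := by
          calc |G w| * w i₀ = |φ w + (d + c)| := by
                rw [← abs_neg, ← Nat.abs_cast, ← abs_mul]
                congr 1
                linear_combination -h
            _ ≤ |φ w| + |d + c| := abs_add_le _ _
            _ ≤ C * w i₀ + |d + c| * w i₀ :=
                add_le_add h3 (le_mul_of_one_le_right (abs_nonneg _) h1')
            _ = _ := by ring
        have h5 := abs_le.1 (le_of_mul_le_mul_right h4 (by omega))
        constructor <;> linarith [h5.1, h5.2]
      · rintro ⟨q, -, h1, hw, h2⟩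
        exact ⟨hw, by linear_combination h1 + w i₀ * h2⟩
    rw [key]
    exact .biUnion (finite_Icc _ _) fun q _ =>
      (isSemilinearSet_setOfPred_eq (d + c) 0 φ _).inter (ih q)

end PolynomialForms

theorem isSemilinearSet_setOfPred_lt {ι : Type} [Finite ι] (i j : ι) :
    IsSemilinearSet {w : ι → ℕ | w i < w j} := by
  have : {w : ι → ℕ | w i < w j} = {w | ∃ y : Unit → ℕ, w i + y () + 1 = w j} := by
    ext w
    exact ⟨fun h => ⟨fun _ => w j - w i - 1, by simp only [mem_ofPred_eq] at h ⊢; omega⟩,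
      fun ⟨y, h⟩ => by simp only [mem_ofPred_eq]; omega⟩
  rw [this]
  refine .proj' ?_
  convert! isSemilinearSet_setOfPred_eq (M := ι ⊕ Unit → ℕ) 1 0
    (Pi.evalAddMonoidHom (fun _ : ι ⊕ Unit => ℕ) (.inl i) + Pi.evalAddMonoidHom _ (.inr ()))
    (Pi.evalAddMonoidHom (fun _ : ι ⊕ Unit => ℕ) (.inl j)) using 3
  simp
  omega

theorem isSemilinearSet_setOfPred_const_le {ι : Type} [Finite ι] (c : ℕ) (j : ι) :
    IsSemilinearSet {w : ι → ℕ | c ≤ w j} := by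
  have := (IsSemilinearSet.of_finite (finite_Iio c)).compl.preimage
    (Pi.evalAddMonoidHom (fun _ : ι => ℕ) j)
  convert! this using 1
  ext w
  simp

section Digits

theorem sum_digits_lt {n e : ℕ} {d : Fin e → ℕ} (hd : ∀ j, d j < n) :
    ∑ j, d j * n ^ (j : ℕ) < n ^ e := by
  simpa [finFunctionFinEquiv_apply] using (finFunctionFinEquiv fun j => ⟨d j, hd j⟩).2

theorem exists_digits {n e z : ℕ} (hz : z < n ^ e) :
    ∃ d : Fin e → ℕ, (∀ j, d j < n) ∧ ∑ j, d j * n ^ (j : ℕ) = z := by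
  refine ⟨fun j => finFunctionFinEquiv.symm ⟨z, hz⟩ j, fun j => Fin.isLt _, ?_⟩
  rw [← finFunctionFinEquiv_apply, Equiv.apply_symm_apply]

theorem digits_unique {n e : ℕ} {d d' : Fin e → ℕ} (hd : ∀ j, d j < n) (hd' : ∀ j, d' j < n)
    (h : ∑ j, d j * n ^ (j : ℕ) = ∑ j, d' j * n ^ (j : ℕ)) : d = d' := by
  have : (fun j => ⟨d j, hd j⟩ : Fin e → Fin n) = fun j => ⟨d' j, hd' j⟩ := by
    apply finFunctionFinEquiv.injective
    ext
    simpa [finFunctionFinEquiv_apply] using h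
  ext j
  simpa using congr_fun this j

end Digits

theorem Polynomial.exists_abs_eval_le_pow (p : Polynomial ℤ) :
    ∃ D : ℕ, ∀ n : ℕ, 2 ≤ n → |p.eval (n : ℤ)| ≤ (n : ℤ) ^ D := by
  induction p using Polynomial.induction_on' with
  | add p q hp hq =>
    obtain ⟨D, hD⟩ := hp
    obtain ⟨D', hD'⟩ := hq
    refine ⟨max D D' + 1, fun n hn => ?_⟩
    have hn' : (2 : ℤ) ≤ n := by exact_mod_cast hn
    have h1 := (hD n hn).trans (pow_le_pow_right₀ (by omega) (le_max_left D D'))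
    have h2 := (hD' n hn).trans (pow_le_pow_right₀ (by omega) (le_max_right D D'))
    rw [Polynomial.eval_add, pow_succ]
    refine (abs_add_le _ _).trans ?_
    nlinarith [pow_nonneg (show (0 : ℤ) ≤ n by omega) (max D D')]
  | monomial m a =>
    refine ⟨a.natAbs + m, fun n hn => ?_⟩
    have h1 : |a| ≤ (n : ℤ) ^ a.natAbs := by
      rw [Int.abs_eq_natAbs]
      exact_mod_cast Nat.lt_two_pow_self.le.trans (Nat.pow_le_pow_left hn _)
    rw [Polynomial.eval_monomial, abs_mul, abs_pow, Nat.abs_cast, pow_add]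
    gcongr

section PseudoFrobenius

variable {k : ℕ} {f : Fin k → ℕ → ℕ} {n : ℕ}

theorem mem_SGZ_iff {s : ℤ} : s ∈ SGZ k f n ↔ ∃ c : Fin k → ℕ, s = ∑ i, (c i : ℤ) * f i n := by
  simp only [SGZ, mem_image, SetLike.mem_coe, SG, AddSubmonoid.mem_closure_range_iff_of_fintype]
  constructor
  · rintro ⟨_, ⟨c, rfl⟩, rfl⟩
    exact ⟨c, by simp⟩
  · rintro ⟨c, rfl⟩
    exact ⟨_, ⟨c, rfl⟩, by simp⟩

theorem sum_single (i : Fin k) (a : ℕ) :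
    ∑ j, ((Pi.single i a : Fin k → ℕ) j : ℤ) * f j n = a * f i n := by
  rw [Finset.sum_eq_single i (fun j _ hj => by simp [hj]) (by simp)]
  simp

theorem sum_eq_single_add {c : Fin k → ℕ} {i : Fin k} {a : ℕ} (ha : a ≤ c i) :
    ∑ j, (c j : ℤ) * f j n =
      a * f i n + ∑ j, ((c - Pi.single i a : Fin k → ℕ) j : ℤ) * f j n := by
  have hc : c = Pi.single i a + (c - Pi.single i a) := by
    ext j
    rcases eq_or_ne j i with rfl | hj
    · simp [ha]
    · simp [hj]
  conv_lhs => rw [hc]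
  simp only [Pi.add_apply, Nat.cast_add, add_mul, Finset.sum_add_distrib, sum_single]

theorem SGZ_add {s t : ℤ} (hs : s ∈ SGZ k f n) (ht : t ∈ SGZ k f n) : s + t ∈ SGZ k f n := by
  obtain ⟨c, rfl⟩ := mem_SGZ_iff.1 hs
  obtain ⟨d, rfl⟩ := mem_SGZ_iff.1 ht
  exact mem_SGZ_iff.2 ⟨c + d, by simp [add_mul, Finset.sum_add_distrib]⟩

theorem mem_SGZ_generator (i : Fin k) : (f i n : ℤ) ∈ SGZ k f n :=
  mem_SGZ_iff.2 ⟨Pi.single i 1, by simp [Pi.single_apply]⟩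

/-- The defining condition of a pseudo-Frobenius number need only be tested on generators. -/
theorem mem_PF_iff {x : ℤ} : x ∈ PF k f n ↔
    x ∉ SGZ k f n ∧ ∀ i, f i n = 0 ∨ x + f i n ∈ SGZ k f n := by
  refine and_congr_right fun _ => ⟨fun h i => or_iff_not_imp_left.2 fun hi =>
    h _ (mem_SGZ_generator i) (by exact_mod_cast hi), fun h s hs hs0 => ?_⟩
  obtain ⟨c, rfl⟩ := mem_SGZ_iff.1 hs
  obtain ⟨i, -, hi⟩ := Finset.exists_ne_zero_of_sum_ne_zero hs0
  obtain ⟨hci, hfi⟩ := mul_ne_zero_iff.1 hi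
  have hx := (h i).resolve_left (by exact_mod_cast hfi)
  have hc := sum_eq_single_add (f := f) (n := n) (i := i) (c := c) (a := 1)
    (Nat.one_le_iff_ne_zero.2 (by exact_mod_cast hci))
  rw [Nat.cast_one, one_mul] at hc
  rw [hc, ← add_assoc]
  exact SGZ_add hx (mem_SGZ_iff.2 ⟨_, rfl⟩)

/-- Elements of the semigroup have expressions in terms of the generators whose coefficients are
at most the element. -/
theorem exists_coeff_le {s : ℤ} (hs : s ∈ SGZ k f n) :
    ∃ c : Fin k → ℕ, s = ∑ i, (c i : ℤ) * f i n ∧ ∀ i, (c i : ℤ) ≤ s := by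
  obtain ⟨c, rfl⟩ := mem_SGZ_iff.1 hs
  refine ⟨fun i => if f i n = 0 then 0 else c i, ?_, fun i => ?_⟩
  · refine Finset.sum_congr rfl fun i _ => ?_
    by_cases h : f i n = 0 <;> simp [h]
  · have hnn : ∀ j ∈ Finset.univ, (0 : ℤ) ≤ (c j : ℤ) * f j n := fun j _ => by positivity
    beta_reduce
    split_ifs with h
    · simpa using Finset.sum_nonneg hnn
    · refine le_trans ?_ (Finset.single_le_sum hnn (Finset.mem_univ i))
      exact le_mul_of_one_le_right (by positivity) (by exact_mod_cast Nat.one_le_iff_ne_zero.2 h)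

/-- An Apéry-type bound: an element `s` of the semigroup such that `s - f i₀ n` is not in the
semigroup is a combination of generators with small coefficients. -/
theorem le_of_sub_notMem_SGZ {s : ℤ} (hs : s ∈ SGZ k f n) {i₀ : Fin k}
    (hs' : s - f i₀ n ∉ SGZ k f n) {M : ℤ} (hM : ∀ i, (f i n : ℤ) ≤ M) : s ≤ k * (M * M) := by
  obtain ⟨c, rfl⟩ := mem_SGZ_iff.1 hs
  have key : ∀ i, (c i : ℤ) * f i n ≤ M * M := by
    intro i
    have hM0 : (0 : ℤ) ≤ M := le_trans (by positivity) (hM i)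
    rcases Nat.eq_zero_or_pos (f i n) with h0 | h0
    · simpa [h0] using mul_nonneg hM0 hM0
    refine mul_le_mul (le_trans ?_ (hM i₀)) (hM i) (by positivity) hM0
    by_contra! hlt
    apply hs'
    refine mem_SGZ_iff.2 ⟨c - Pi.single i (f i₀ n) + Pi.single i₀ (f i n - 1), ?_⟩
    rw [sum_eq_single_add (i := i) (a := f i₀ n) (by exact_mod_cast hlt.le)]
    simp only [Pi.add_apply, Nat.cast_add, add_mul, Finset.sum_add_distrib]
    rw [sum_single, Nat.cast_sub h0]
    push_cast
    ring
  calc ∑ i, (c i : ℤ) * f i n ≤ ∑ _i : Fin k, M * M := Finset.sum_le_sum fun i _ => key i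
    _ = _ := by simp

theorem PF_bounds {i₀ : Fin k} (hi₀ : f i₀ n ≠ 0) {M : ℤ} (hM : ∀ i, (f i n : ℤ) ≤ M) {x : ℤ}
    (hx : x ∈ PF k f n) : -M ≤ x ∧ x ≤ k * (M * M) := by
  obtain ⟨hx, hx'⟩ := mem_PF_iff.1 hx
  have h := (hx' i₀).resolve_left hi₀
  have h1 := le_of_sub_notMem_SGZ h (i₀ := i₀) (by simpa using hx) hM
  have h2 : 0 ≤ x + f i₀ n := by
    obtain ⟨m, -, hm⟩ := h
    rw [← hm]
    positivity
  have := hM i₀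
  constructor <;> omega

/-- Membership in the semigroup in terms of base `n` digits of coefficients. -/
theorem mem_SGZ_iff_digits {E : ℕ} {s : ℤ} (hs : s < (n : ℤ) ^ E) : s ∈ SGZ k f n ↔
    ∃ y : Fin k × Fin E → ℕ, (∀ j, y j < n) ∧
      s = ∑ i, (f i n : ℤ) * ∑ j, (y (i, j) : ℤ) * (n : ℤ) ^ (j : ℕ) := by
  constructor
  · intro h
    obtain ⟨c, hc, hcs⟩ := exists_coeff_le h
    choose d hd hd' using fun i =>
      exists_digits (n := n) (e := E) (z := c i) (by exact_mod_cast (hcs i).trans_lt hs)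
    refine ⟨fun j => d j.1 j.2, fun j => hd _ _, ?_⟩
    rw [hc]
    refine Finset.sum_congr rfl fun i _ => ?_
    rw [← hd' i]
    push_cast
    ring
  · rintro ⟨y, -, rfl⟩
    exact mem_SGZ_iff.2 ⟨fun i => ∑ j, y (i, j) * n ^ (j : ℕ),
      Finset.sum_congr rfl fun i _ => by push_cast; ring⟩

end PseudoFrobenius

section Representation

/-- Digit vectors `w (some j) < w none` in base `w none ≥ 2`. -/
def digitBox (e : ℕ) : Set (Option (Fin e) → ℕ) :=
  {w | 2 ≤ w none ∧ ∀ j, w (some j) < w none}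

/-- The number with base `w none` digits `w (some j)`. -/
def digitValue {e : ℕ} (w : Option (Fin e) → ℕ) : ℕ :=
  ∑ j, w (some j) * w none ^ (j : ℕ)

/-- The digit vectors whose value, shifted by `q`, is a combination of the `p i` with coefficients
having at most `E` digits. -/
def representable {k : ℕ} (p : Fin k → Polynomial ℤ) (e E : ℕ) (q : Polynomial ℤ) :
    Set (Option (Fin e) → ℕ) :=
  {w | ∃ y : Fin k × Fin E → ℕ, (w ∈ digitBox e ∧ ∀ j, y j < w none) ∧
    (digitValue w : ℤ) + q.eval (w none : ℤ) =
      ∑ i, (p i).eval (w none : ℤ) * ∑ j, (y (i, j) : ℤ) * (w none : ℤ) ^ (j : ℕ)}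

theorem isSemilinearSet_digitBox (e : ℕ) : IsSemilinearSet (digitBox e) := by
  have : digitBox e = {w | 2 ≤ w none} ∩ ⋂ j, {w | w (some j) < w none} := by
    ext w
    simp [digitBox]
  rw [this]
  exact (isSemilinearSet_setOfPred_const_le 2 none).inter
    (.iInter fun j => isSemilinearSet_setOfPred_lt (some j) none)

theorem le_of_mem_digitBox {e : ℕ} {w : Option (Fin e) → ℕ} (hw : w ∈ digitBox e) :
    1 ≤ w none ∧ ∀ i, w i ≤ w none :=
  ⟨one_le_two.trans hw.1, fun i => match i with
    | none => le_rfl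
    | some j => (hw.2 j).le⟩

theorem isSemilinearSet_eval_eq_zero (e : ℕ) (p : Polynomial ℤ) :
    IsSemilinearSet {w ∈ digitBox e | p.eval (w none : ℤ) = 0} := by
  simpa using (IsPolyAffine.eval (i₀ := none) p).isSemilinearSet (isSemilinearSet_digitBox e)
    (fun _ => le_of_mem_digitBox) 0

theorem isSemilinearSet_representable {k : ℕ} (p : Fin k → Polynomial ℤ) (e E : ℕ)
    (q : Polynomial ℤ) : IsSemilinearSet (representable p e E q) := by
  refine .proj' ?_
  let ι := Option (Fin e) ⊕ (Fin k × Fin E)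
  let i₀ : ι := .inl none
  let B : Set (ι → ℕ) := {w | w ∘ Sum.inl ∈ digitBox e} ∩ ⋂ j, {w | w (.inr j) < w i₀}
  have hB : IsSemilinearSet B := by
    refine .inter ?_ (.iInter fun j => isSemilinearSet_setOfPred_lt _ _)
    exact (isSemilinearSet_digitBox e).preimage (LinearMap.funLeft ℕ ℕ Sum.inl)
  have hB' : ∀ w ∈ B, 1 ≤ w i₀ ∧ ∀ i, w i ≤ w i₀ := by
    rintro w ⟨h1, h2⟩
    have h3 := le_of_mem_digitBox h1
    refine ⟨h3.1, fun i => ?_⟩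
    rcases i with i | j
    · exact h3.2 i
    · exact (mem_iInter.1 h2 j).le
  have hF : IsPolyAffine i₀ fun w : ι → ℕ =>
      (∑ j, (w (.inl (some j)) : ℤ) * (w i₀ : ℤ) ^ (j : ℕ) + q.eval (w i₀ : ℤ)) +
        (-1) * ∑ i, (p i).eval (w i₀ : ℤ) *
          ∑ j, (w (.inr (i, j)) : ℤ) * (w i₀ : ℤ) ^ (j : ℕ) :=
    ((IsPolyAffine.digits _).add (.eval q)).add
      ((IsPolyAffine.sum _ fun i _ => (IsPolyAffine.digits _).eval_mul (p i)).const_mul (-1))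
  convert! hF.isSemilinearSet hB hB' 0 using 1
  ext w
  simp only [mem_ofPred_eq, B, mem_inter_iff, mem_iInter, digitValue, Function.comp_apply, i₀,
    add_zero, neg_one_mul, ← sub_eq_add_neg, sub_eq_zero]
  push_cast
  rfl

end Representation

/-- The digit vectors of the numbers `x + n ^ D`, where `x` is a pseudo-Frobenius number. -/
def pseudoFrobeniusDigits {k : ℕ} (p : Fin k → Polynomial ℤ) (D e E : ℕ) :
    Set (Option (Fin e) → ℕ) :=
  (digitBox e \ representable p e E (-Polynomial.X ^ D)) ∩
    ⋂ i, ({w ∈ digitBox e | (p i).eval (w none : ℤ) = 0} ∪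
      representable p e E (p i - Polynomial.X ^ D))

theorem isSemilinearSet_pseudoFrobeniusDigits {k : ℕ} (p : Fin k → Polynomial ℤ) (D e E : ℕ) :
    IsSemilinearSet (pseudoFrobeniusDigits p D e E) :=
  ((isSemilinearSet_digitBox e).sdiff (isSemilinearSet_representable p e E _)).inter
    (.iInter fun i => (isSemilinearSet_eval_eq_zero e (p i)).union
      (isSemilinearSet_representable p e E _))

theorem mem_representable_iff {k : ℕ} {f : Fin k → ℕ → ℕ} {p : Fin k → Polynomial ℤ}
    (hp : ∀ i (n : ℕ), (f i n : ℤ) = (p i).eval (n : ℤ)) {e E : ℕ} {q : Polynomial ℤ}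
    {w : Option (Fin e) → ℕ} (hw : w ∈ digitBox e)
    (hE : (digitValue w : ℤ) + q.eval (w none : ℤ) < (w none : ℤ) ^ E) :
    w ∈ representable p e E q ↔ (digitValue w : ℤ) + q.eval (w none : ℤ) ∈ SGZ k f (w none) := by
  rw [mem_SGZ_iff_digits hE]
  simp only [representable, mem_ofPred_eq, hw, true_and, hp]

theorem mem_pseudoFrobeniusDigits_iff {k : ℕ} {f : Fin k → ℕ → ℕ} {p : Fin k → Polynomial ℤ}
    (hp : ∀ i (n : ℕ), (f i n : ℤ) = (p i).eval (n : ℤ)) {D e : ℕ} (hDe : D ≤ e)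
    {w : Option (Fin e) → ℕ} (hw : w ∈ digitBox e)
    (hD : ∀ i, (f i (w none) : ℤ) ≤ (w none : ℤ) ^ D) :
    w ∈ pseudoFrobeniusDigits p D e (e + 1) ↔
      (digitValue w : ℤ) - (w none : ℤ) ^ D ∈ PF k f (w none) := by
  have hn : (2 : ℤ) ≤ w none := by exact_mod_cast hw.1
  have hpow : (w none : ℤ) ^ D ≤ (w none : ℤ) ^ e := pow_le_pow_right₀ (by omega) hDe
  have hpos : (0 : ℤ) ≤ (w none : ℤ) ^ D := by positivity
  have hz : (digitValue w : ℤ) < (w none : ℤ) ^ e := by exact_mod_cast sum_digits_lt hw.2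
  have hE : 2 * (w none : ℤ) ^ e ≤ (w none : ℤ) ^ (e + 1) := by
    rw [pow_succ']
    gcongr
  have h1 := mem_representable_iff hp hw (E := e + 1) (q := -Polynomial.X ^ D)
    (by simp; linarith)
  have h2 : ∀ i, w ∈ representable p e (e + 1) (p i - Polynomial.X ^ D) ↔ _ := fun i =>
    mem_representable_iff hp hw (by
      have := hD i
      rw [Polynomial.eval_sub, ← hp]
      simp
      linarith)
  simp only [pseudoFrobeniusDigits, mem_inter_iff, mem_sdiff, mem_iInter, mem_union, hw, true_and,
    mem_ofPred_eq, h1, h2, mem_PF_iff, ← hp, Polynomial.eval_sub, Polynomial.eval_neg,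
    Polynomial.eval_pow, Polynomial.eval_X, Nat.cast_eq_zero, ← sub_eq_add_neg]
  refine and_congr_right fun _ => forall_congr' fun i => ?_
  rw [add_sub_assoc', add_sub_right_comm]

/-- If some generator is nonzero, there are as many pseudo-Frobenius numbers as digit vectors. -/
theorem ncard_pseudoFrobeniusDigits {k : ℕ} {f : Fin k → ℕ → ℕ} {p : Fin k → Polynomial ℤ}
    (hp : ∀ i (n : ℕ), (f i n : ℤ) = (p i).eval (n : ℤ)) {D n : ℕ} (hn : 2 ≤ n)
    (hD : ∀ i, (f i n : ℤ) ≤ (n : ℤ) ^ D) {i₀ : Fin k} (hi₀ : f i₀ n ≠ 0) :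
    (levelSet (pseudoFrobeniusDigits p D (2 * D + k + 2) (2 * D + k + 2 + 1))
      (Pi.evalAddMonoidHom _ none) n).ncard = (PF k f n).ncard := by
  set e := 2 * D + k + 2 with he
  have hn' : (2 : ℤ) ≤ n := by exact_mod_cast hn
  have hDe : D ≤ e := by omega
  refine ncard_congr (fun w _ => (digitValue w : ℤ) - (n : ℤ) ^ D) ?_ ?_ ?_
  · rintro w ⟨hw, rfl⟩
    exact (mem_pseudoFrobeniusDigits_iff hp hDe hw.1.1 hD).1 hw
  · rintro w w' ⟨hw, hwn⟩ ⟨hw', hwn'⟩ h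
    replace hwn : w none = n := hwn
    replace hwn' : w' none = n := hwn'
    have h' : digitValue w = digitValue w' := by simpa using h
    have hb := hw.1.1.2
    have hb' := hw'.1.1.2
    simp only [digitValue, hwn, hwn'] at h' hb hb'
    have := digits_unique hb hb' h'
    ext i
    rcases i with _ | j
    · rw [hwn, hwn']
    · exact congr_fun this j
  · intro x hx
    obtain ⟨h1, h2⟩ := PF_bounds hi₀ hD hx
    have hk : (k : ℤ) ≤ (n : ℤ) ^ k := by
      exact_mod_cast Nat.lt_two_pow_self.le.trans (Nat.pow_le_pow_left hn _)
    have hpos : (0 : ℤ) < (n : ℤ) ^ (2 * D + k) := by positivity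
    have h3 : x ≤ (n : ℤ) ^ (2 * D + k) := by
      refine h2.trans ?_
      calc (k : ℤ) * ((n : ℤ) ^ D * (n : ℤ) ^ D) ≤ (n : ℤ) ^ k * ((n : ℤ) ^ D * (n : ℤ) ^ D) := by
            gcongr
        _ = _ := by ring
    have h4 : (n : ℤ) ^ D ≤ (n : ℤ) ^ (2 * D + k) := pow_le_pow_right₀ (by omega) (by omega)
    have h5 : (4 : ℤ) * (n : ℤ) ^ (2 * D + k) ≤ (n : ℤ) ^ e := by
      rw [he, pow_add _ (2 * D + k) 2, mul_comm]
      gcongr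
      nlinarith
    obtain ⟨z, hz⟩ := Int.eq_ofNat_of_zero_le (show 0 ≤ x + (n : ℤ) ^ D by omega)
    have hze : z < n ^ e := by
      have : (z : ℤ) < (n : ℤ) ^ e := by omega
      exact_mod_cast this
    obtain ⟨d, hd, hdz⟩ := exists_digits hze
    let w : Option (Fin e) → ℕ := fun i => i.elim n d
    have hw : w ∈ digitBox e := ⟨hn, hd⟩
    have hv : (digitValue w : ℤ) - (n : ℤ) ^ D = x := by
      rw [show digitValue w = z from hdz]
      omega
    exact ⟨w, ⟨(mem_pseudoFrobeniusDigits_iff hp hDe hw hD).2 (by rwa [← hv] at hx), rfl⟩, hv⟩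

theorem finite_levelSet_pseudoFrobeniusDigits {k : ℕ} (p : Fin k → Polynomial ℤ) (D e E n : ℕ) :
    (levelSet (pseudoFrobeniusDigits p D e E) (Pi.evalAddMonoidHom _ none) n).Finite := by
  refine (Set.finite_Iic (fun _ => n : Option (Fin e) → ℕ)).subset ?_
  rintro w ⟨hw, rfl⟩
  exact (le_of_mem_digitBox hw.1.1).2

theorem exists_ne_zero_of_finite_compl {k : ℕ} {f : Fin k → ℕ → ℕ} {n : ℕ}
    (h : ((SG k f n : Set ℕ)ᶜ).Finite) : ∃ i, f i n ≠ 0 := by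
  by_contra! h0
  have : SG k f n = ⊥ := by
    rw [SG, eq_bot_iff, AddSubmonoid.closure_le]
    rintro _ ⟨i, rfl⟩
    exact h0 i
  rw [this] at h
  exact h.infinite_compl (by simp)

theorem stmt4 (k : ℕ) (hk : 1 ≤ k) (f : Fin k → ℕ → ℕ)
    (hf : ∀ i, ∃ p : Polynomial ℤ, ∀ n : ℕ, (f i n : ℤ) = p.eval (n : ℤ)) :
    ∃ g : ℕ → ℤ, IsEQP g ∧
      ∀ n : ℕ, ((SG k f n : Set ℕ)ᶜ).Finite →
        g n = ((PF k f n).ncard : ℤ) := by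
  choose p hp using hf
  choose D hD using fun i => (p i).exists_abs_eval_le_pow
  have hD' : ∀ n : ℕ, 2 ≤ n → ∀ i, (f i n : ℤ) ≤ (n : ℤ) ^ ∑ j, D j := by
    intro n hn i
    rw [hp]
    exact (le_abs_self _).trans ((hD i n hn).trans (pow_le_pow_right₀ (by exact_mod_cast by omega)
      (Finset.single_le_sum (fun _ _ => Nat.zero_le _) (Finset.mem_univ i))))
  set A := pseudoFrobeniusDigits p (∑ j, D j) (2 * (∑ j, D j) + k + 2)
    (2 * (∑ j, D j) + k + 2 + 1) with hA
  have hcount := (isSemilinearSet_pseudoFrobeniusDigits p (∑ j, D j) (2 * (∑ j, D j) + k + 2)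
    (2 * (∑ j, D j) + k + 2 + 1)).countsQuasiPoly (Pi.evalAddMonoidHom _ none)
    (finite_levelSet_pseudoFrobeniusDigits p _ _ _)
  refine ⟨fun n => if 2 ≤ n then (levelSet A (Pi.evalAddMonoidHom _ none) n).ncard
    else (PF k f n).ncard, EventuallyQuasiPoly.isEQP (hcount.congr 2 fun n hn => ?_),
    fun n hfin => ?_⟩
  · simp [hn, hA]
  · beta_reduce
    split_ifs with hn
    · obtain ⟨i₀, hi₀⟩ := exists_ne_zero_of_finite_compl hfin
      rw [hA, ncard_pseudoFrobeniusDigits hp hn (hD' n hn) hi₀]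
    · rfl
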